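/- arXiv:2212.08732 — 5 statements merged into one kernel-verified Lean document; each statement's English description precedes it below -/
import Mathlib

section
/- Let B be a C*-algebra and let (e_n) be an approximate unit for B satisfying e_{n+1} e_n = e_n for all n ≥ 1; set e_0 := 0 and r_n := e_n − e_{n−1}. Then for every bounded sequence (α_n) of complex numbers, the series Σ_{n=1}^∞ α_n r_n converges strictly in 𝓜(B): there exists Y ∈ 𝓜(B) such that for every b ∈ B, (Σ_{n=1}^N α_n r_n)·b → Y·b and b·(Σ_{n=1}^N α_n r_n) → b·Y in norm as N → ∞. -/
open scoped MultiplierAlgebra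

/-- `(e n)` is a (sequential) approximate unit for `B`: positive contractions with
`‖e n * b - b‖ → 0` and `‖b * e n - b‖ → 0` for every `b ∈ B`. -/
def IsApproximateUnit {B : Type*} [NonUnitalCStarAlgebra B] [PartialOrder B]
    [StarOrderedRing B] (e : ℕ → B) : Prop :=
  (∀ n, 0 ≤ e n) ∧ (∀ n, ‖e n‖ ≤ 1) ∧
    (∀ b : B, Filter.Tendsto (fun n => ‖e n * b - b‖) Filter.atTop (nhds 0)) ∧
    (∀ b : B, Filter.Tendsto (fun n => ‖b * e n - b‖) Filter.atTop (nhds 0))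

/-- The series `Σ_{j=1}^∞ b j` converges strictly to `Y` in the multiplier algebra
`𝓜(ℂ, B)`: for every `x ∈ B`, the partial sums multiplied (on either side) by `x`
converge in norm to `Y * x` resp. `x * Y`. -/
def StrictlySumsTo {B : Type*} [NonUnitalCStarAlgebra B] (b : ℕ → B) (Y : 𝓜(ℂ, B)) : Prop :=
  ∀ x : B,
    Filter.Tendsto (fun N => (↑(∑ j ∈ Finset.Icc 1 N, b j) : 𝓜(ℂ, B)) * (x : 𝓜(ℂ, B)))
      Filter.atTop (nhds (Y * (x : 𝓜(ℂ, B)))) ∧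
    Filter.Tendsto (fun N => (x : 𝓜(ℂ, B)) * (↑(∑ j ∈ Finset.Icc 1 N, b j) : 𝓜(ℂ, B)))
      Filter.atTop (nhds ((x : 𝓜(ℂ, B)) * Y))

open Filter Topology

section Order

variable {B : Type*} [NonUnitalCStarAlgebra B] [PartialOrder B] [StarOrderedRing B]

lemma mul_self_le_of_nonneg_of_norm_le_one {a : B} (ha : 0 ≤ a) (ha1 : ‖a‖ ≤ 1) :
    a * a ≤ a := by
  have hs : IsSelfAdjoint (CFC.sqrt a) := (CFC.sqrt_nonneg a).isSelfAdjoint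
  have hss : CFC.sqrt a * CFC.sqrt a = a := CFC.sqrt_mul_sqrt_self a ha
  have h := CStarAlgebra.star_right_conjugate_le_norm_smul (a := CFC.sqrt a)
    ha.isSelfAdjoint
  rw [hs.star_eq, hss] at h
  have hmul : CFC.sqrt a * a * CFC.sqrt a = a * a := by
    calc CFC.sqrt a * a * CFC.sqrt a
        = CFC.sqrt a * (CFC.sqrt a * CFC.sqrt a) * CFC.sqrt a := by rw [hss]
      _ = (CFC.sqrt a * CFC.sqrt a) * (CFC.sqrt a * CFC.sqrt a) := by simp only [mul_assoc]
      _ = a * a := by rw [hss]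
  rw [hmul] at h
  calc a * a ≤ ‖a‖ • a := h
    _ ≤ (1 : ℝ) • a := smul_le_smul_of_nonneg_right ha1 ha
    _ = a := one_smul _ _

lemma le_of_mul_eq_of_norm_le_one {a b : B} (ha : 0 ≤ a) (ha1 : ‖a‖ ≤ 1) (hb : 0 ≤ b)
    (hb1 : ‖b‖ ≤ 1) (hba : b * a = a) : a ≤ b := by
  have h := CStarAlgebra.star_right_conjugate_le_norm_smul (a := b) ha.isSelfAdjoint
  have hab : a * b = a := by
    simpa [ha.isSelfAdjoint.star_eq, hb.isSelfAdjoint.star_eq] using congrArg star hba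
  rw [hb.isSelfAdjoint.star_eq, hba, hab] at h
  calc a ≤ ‖a‖ • (b * b) := h
    _ ≤ (1 : ℝ) • (b * b) := smul_le_smul_of_nonneg_right ha1 hb.isSelfAdjoint.mul_self_nonneg
    _ = b * b := one_smul _ _
    _ ≤ b := mul_self_le_of_nonneg_of_norm_le_one hb hb1

lemma norm_sum_smul_le_of_nonneg {ι : Type*} (s : Finset ι) {r : ι → B} (hr : ∀ i ∈ s, 0 ≤ r i)
    {β : ι → ℝ} {C : ℝ} (hβ : ∀ i ∈ s, 0 ≤ β i) (hβC : ∀ i ∈ s, β i ≤ C) :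
    ‖∑ i ∈ s, β i • r i‖ ≤ |C| * ‖∑ i ∈ s, r i‖ := by
  rw [← Real.norm_eq_abs, ← norm_smul, Finset.smul_sum]
  exact CStarAlgebra.norm_le_norm_of_nonneg_of_le
    (Finset.sum_nonneg fun i hi => smul_nonneg (hβ i hi) (hr i hi))
    (Finset.sum_le_sum fun i hi => smul_le_smul_of_nonneg_right (hβC i hi) (hr i hi))

lemma norm_sum_complex_smul_le {ι : Type*} (s : Finset ι) {r : ι → B} (hr : ∀ i ∈ s, 0 ≤ r i)
    {α : ι → ℂ} {C : ℝ} (hα : ∀ i, ‖α i‖ ≤ C) :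
    ‖∑ i ∈ s, α i • r i‖ ≤ 6 * |C| * ‖∑ i ∈ s, r i‖ := by
  have hre : ∀ i, |(α i).re| ≤ C := fun i => (Complex.abs_re_le_norm _).trans (hα i)
  have him : ∀ i, |(α i).im| ≤ C := fun i => (Complex.abs_im_le_norm _).trans (hα i)
  have h1 := norm_sum_smul_le_of_nonneg s hr (β := fun i => (α i).re + C) (C := 2 * C)
    (fun i _ => by linarith [(abs_le.1 (hre i)).1]) (fun i _ => by linarith [(abs_le.1 (hre i)).2])
  have h2 := norm_sum_smul_le_of_nonneg s hr (β := fun i => (α i).im + C) (C := 2 * C)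
    (fun i _ => by linarith [(abs_le.1 (him i)).1]) (fun i _ => by linarith [(abs_le.1 (him i)).2])
  have hdecomp : ∑ i ∈ s, α i • r i = ∑ i ∈ s, ((α i).re + C) • r i
      + Complex.I • ∑ i ∈ s, ((α i).im + C) • r i
      - ((C : ℂ) • ∑ i ∈ s, r i + Complex.I • (C : ℂ) • ∑ i ∈ s, r i) := by
    simp only [Finset.smul_sum, ← Finset.sum_add_distrib, ← Finset.sum_sub_distrib]
    refine Finset.sum_congr rfl fun i _ => ?_
    simp only [← Complex.coe_smul, smul_smul, ← add_smul, ← sub_smul]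
    congr 1
    apply Complex.ext <;> simp
  have hC : ‖(C : ℂ) • ∑ i ∈ s, r i‖ = |C| * ‖∑ i ∈ s, r i‖ := by
    rw [norm_smul, Complex.norm_real, Real.norm_eq_abs]
  have hI : ∀ b : B, ‖Complex.I • b‖ = ‖b‖ := fun b => by simp [norm_smul]
  rw [hdecomp]
  refine (norm_sub_le_of_le (norm_add_le_of_le h1 ((hI _).trans_le h2))
    (norm_add_le_of_le hC.le ((hI _).trans_le hC.le))).trans_eq ?_
  rw [abs_mul, abs_two]
  ring

end Order

/-- A bounded sequence of operators that is pointwise Cauchy along a sequence tending to `x` is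
pointwise Cauchy at `x`. -/
lemma cauchySeq_apply_of_tendsto {𝕜 E F : Type*} [NontriviallyNormedField 𝕜]
    [SeminormedAddCommGroup E] [NormedSpace 𝕜 E] [SeminormedAddCommGroup F] [NormedSpace 𝕜 F]
    {f : ℕ → E →L[𝕜] F} {K : ℝ} (hK : ∀ n, ‖f n‖ ≤ K) {u : ℕ → E} {x : E}
    (hu : Tendsto u atTop (𝓝 x)) (h : ∀ k, CauchySeq fun n => f n (u k)) :
    CauchySeq fun n => f n x := by
  have hK0 : 0 ≤ K := (norm_nonneg _).trans (hK 0)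
  have hbd : ∀ n y, ‖f n y‖ ≤ K * ‖y‖ := fun n y => (f n).le_of_opNorm_le (hK n) y
  refine Metric.cauchySeq_iff'.2 fun ε hε => ?_
  obtain ⟨k, hk⟩ := ((Metric.tendsto_atTop.1 hu (ε / (3 * (K + 1))) (by positivity)).imp
    fun k hk => hk k le_rfl)
  obtain ⟨N, hN⟩ := Metric.cauchySeq_iff'.1 (h k) (ε / 3) (by positivity)
  refine ⟨N, fun n hn => ?_⟩
  have hclose : ∀ m, ‖f m (u k - x)‖ < ε / 3 := fun m => by
    rw [dist_eq_norm, lt_div_iff₀ (by positivity)] at hk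
    nlinarith [hbd m (u k - x), norm_nonneg (u k - x)]
  have hNn := hN n hn
  rw [dist_eq_norm] at hNn ⊢
  have hsplit : f n x - f N x = f N (u k - x) - f n (u k - x) + (f n (u k) - f N (u k)) := by
    simp only [map_sub]
    abel
  rw [hsplit]
  linarith [norm_add_le (f N (u k - x) - f n (u k - x)) (f n (u k) - f N (u k)),
    norm_sub_le (f N (u k - x)) (f n (u k - x)), hclose n, hclose N]

open scoped CStarAlgebra in
lemma DoubleCentralizer.continuous_coe {B : Type*} [NonUnitalCStarAlgebra B] :
    Continuous (fun b : B => (b : 𝓜(ℂ, B))) :=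
  map_continuous (DoubleCentralizer.coeHom (𝕜 := ℂ) (A := B))

/-- A sequence that converges pointwise as left and as right multiplication converges strictly
to a multiplier. -/
lemma DoubleCentralizer.exists_tendsto_coe_mul {B : Type*} [NonUnitalCStarAlgebra B] {T : ℕ → B}
    (hl : ∀ x, CauchySeq fun n => T n * x) (hr : ∀ x, CauchySeq fun n => x * T n) :
    ∃ Y : 𝓜(ℂ, B), ∀ x : B,
      Tendsto (fun n => (T n : 𝓜(ℂ, B)) * (x : 𝓜(ℂ, B))) atTop (𝓝 (Y * (x : 𝓜(ℂ, B)))) ∧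
      Tendsto (fun n => (x : 𝓜(ℂ, B)) * (T n : 𝓜(ℂ, B))) atTop (𝓝 ((x : 𝓜(ℂ, B)) * Y)) := by
  choose L hL using fun x => cauchySeq_tendsto_of_complete (hl x)
  choose R hR using fun x => cauchySeq_tendsto_of_complete (hr x)
  have hLR : ∀ x y, R x * y = x * L y := fun x y =>
    tendsto_nhds_unique ((hR x).mul_const y)
      (by simpa only [mul_assoc] using (hL y).const_mul x)
  have hLmul : ∀ x y, L (x * y) = L x * y := fun x y =>
    tendsto_nhds_unique (hL (x * y))
      (by simpa only [mul_assoc] using (hL x).mul_const y)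
  have hRmul : ∀ x y, R (x * y) = x * R y := fun x y =>
    tendsto_nhds_unique (hR (x * y))
      (by simpa only [mul_assoc] using (hR y).const_mul x)
  let Y : 𝓜(ℂ, B) :=
    { fst := continuousLinearMapOfTendsto (fun n => ContinuousLinearMap.mul ℂ B (T n))
        (tendsto_pi_nhds.2 hL)
      snd := continuousLinearMapOfTendsto (fun n => (ContinuousLinearMap.mul ℂ B).flip (T n))
        (tendsto_pi_nhds.2 hR)
      central := hLR }
  have hYfst : ∀ x, Y.fst x = L x := fun _ => rfl
  have hYsnd : ∀ x, Y.snd x = R x := fun _ => rfl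
  have hcoe : ∀ a b : B, (a : 𝓜(ℂ, B)) * (b : 𝓜(ℂ, B)) = ((a * b : B) : 𝓜(ℂ, B)) :=
    fun a b => (map_mul (DoubleCentralizer.coeHom (𝕜 := ℂ) (A := B)) a b).symm
  refine ⟨Y, fun x => ⟨?_, ?_⟩⟩
  · have hYx : Y * (x : 𝓜(ℂ, B)) = (L x : 𝓜(ℂ, B)) := by
      refine DoubleCentralizer.ext _ _ _ _ (Prod.ext ?_ ?_) <;> ext y
      · simp [hYfst, hLmul]
      · simp [hYsnd, hLR]
    simp only [hcoe, hYx]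
    exact (DoubleCentralizer.continuous_coe.tendsto _).comp (hL x)
  · have hxY : (x : 𝓜(ℂ, B)) * Y = (R x : 𝓜(ℂ, B)) := by
      refine DoubleCentralizer.ext _ _ _ _ (Prod.ext ?_ ?_) <;> ext y
      · simp [hYfst, hLR]
      · simp [hYsnd, hRmul]
    simp only [hcoe, hxY]
    exact (DoubleCentralizer.continuous_coe.tendsto _).comp (hR x)

lemma mul_eq_right_of_succ_mul_eq {M : Type*} [Semigroup M] {e : ℕ → M}
    (h : ∀ n, e (n + 1) * e n = e n) {k n : ℕ} (hkn : k < n) : e n * e k = e k := by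
  induction n, hkn using Nat.le_induction with
  | base => exact h k
  | succ n _ ih =>
    calc e (n + 1) * e k = e (n + 1) * (e n * e k) := by rw [ih]
      _ = e k := by rw [← mul_assoc, h, ih]

lemma cauchySeq_sum_Icc_of_eventually_zero {F : Type*} [SeminormedAddCommGroup F] {g : ℕ → F}
    {k : ℕ} (hg : ∀ n, k < n → g n = 0) : CauchySeq fun N => ∑ j ∈ Finset.Icc 1 N, g j := by
  refine (tendsto_const_nhds (x := ∑ j ∈ Finset.Icc 1 k, g j)).congr' ?_ |>.cauchySeq
  filter_upwards [eventually_ge_atTop k] with N hN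
  refine Finset.sum_subset (Finset.Icc_subset_Icc_right hN) fun j hj hjk => hg j ?_
  simp only [Finset.mem_Icc] at hj hjk
  omega

/-- if `(e n)` is an approximate unit with `e (n+1) * e n = e n`
(`e 0 = 0`, `r n := e n - e (n-1)`), then for every bounded sequence `(α n)` of complex
numbers the series `Σ_{n=1}^∞ α n • r n` converges strictly in `𝓜(ℂ, B)`. -/
theorem statement_1 {B : Type*} [NonUnitalCStarAlgebra B] [PartialOrder B] [StarOrderedRing B]
    (e : ℕ → B) (he : IsApproximateUnit e) (he0 : e 0 = 0)
    (hee : ∀ n ≥ 1, e (n + 1) * e n = e n)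
    (α : ℕ → ℂ) (hα : ∃ C : ℝ, ∀ n, ‖α n‖ ≤ C) :
    ∃ Y : 𝓜(ℂ, B), StrictlySumsTo (fun n => α n • (e n - e (n - 1))) Y := by
  obtain ⟨C, hC⟩ := hα
  obtain ⟨hpos, hnorm, hleft, hright⟩ := he
  have hsucc : ∀ n, e (n + 1) * e n = e n := fun n => by
    rcases n.eq_zero_or_pos with rfl | hn
    · simp [he0]
    · exact hee n hn
  have hmul {k n : ℕ} (h : k < n) : e n * e k = e k := mul_eq_right_of_succ_mul_eq hsucc h
  have hmul' {k n : ℕ} (h : k < n) : e k * e n = e k := by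
    simpa [(hpos _).isSelfAdjoint.star_eq] using congrArg star (hmul h)
  have hr : ∀ j, 0 ≤ e j - e (j - 1) := fun j => by
    rcases j with _ | j
    · simp
    · exact sub_nonneg.2 (le_of_mul_eq_of_norm_le_one (hpos _) (hnorm _) (hpos _) (hnorm _)
        (hsucc j))
  have hsum : ∀ N, ∑ j ∈ Finset.Icc 1 N, (e j - e (j - 1)) = e N := fun N => by
    induction N with
    | zero => simp [he0]
    | succ N ih => rw [Finset.sum_Icc_succ_top (by omega), ih]; simp
  set T : ℕ → B := fun N => ∑ j ∈ Finset.Icc 1 N, α j • (e j - e (j - 1)) with hT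
  have hTbound : ∀ N, ‖T N‖ ≤ 6 * |C| := fun N => by
    refine (norm_sum_complex_smul_le _ (fun j _ => hr j) hC).trans ?_
    rw [hsum]
    exact mul_le_of_le_one_right (by positivity) (hnorm N)
  have hlim : ∀ x, Tendsto (fun k => e k * x) atTop (𝓝 x) := fun x =>
    tendsto_iff_norm_sub_tendsto_zero.2 (hleft x)
  have hlim' : ∀ x, Tendsto (fun k => x * e k) atTop (𝓝 x) := fun x =>
    tendsto_iff_norm_sub_tendsto_zero.2 (hright x)
  refine DoubleCentralizer.exists_tendsto_coe_mul (T := T) (fun x => ?_) (fun x => ?_)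
  · refine cauchySeq_apply_of_tendsto (f := fun N => ContinuousLinearMap.mul ℂ B (T N))
      (fun N => (ContinuousLinearMap.opNorm_mul_apply_le ℂ B _).trans (hTbound N)) (hlim x)
      fun k => ?_
    simp only [hT, ContinuousLinearMap.mul_apply', Finset.sum_mul]
    refine cauchySeq_sum_Icc_of_eventually_zero (k := k + 1) fun n hn => ?_
    rw [smul_mul_assoc, ← mul_assoc, sub_mul, hmul (by omega), hmul (by omega)]
    simp
  · refine cauchySeq_apply_of_tendsto (f := fun N => (ContinuousLinearMap.mul ℂ B).flip (T N))
      (K := 6 * |C|) (fun N => ContinuousLinearMap.opNorm_le_bound _ (by positivity) fun y => ?_)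
      (hlim' x) fun k => ?_
    · rw [ContinuousLinearMap.flip_apply, ContinuousLinearMap.mul_apply', mul_comm (6 * |C|)]
      exact norm_mul_le_of_le le_rfl (hTbound N)
    · simp only [hT, ContinuousLinearMap.flip_apply, ContinuousLinearMap.mul_apply',
        Finset.mul_sum]
      refine cauchySeq_sum_Icc_of_eventually_zero (k := k + 1) fun n hn => ?_
      rw [mul_smul_comm, mul_assoc, mul_sub, hmul' (by omega), hmul' (by omega)]
      simp
end

section
/- Let B be a nonunital σ-unital simple C*-algebra, and let (e_n) be an approximate unit for B satisfying e_{n+1} e_n = e_n for all n ≥ 1 (with e_0 := 0 and r_n := e_n − e_{n−1}). Let (α_n) be a sequence in the unit circle S¹ with the close neighbors property, and let Y ∈ 𝓜(B) be the strict sum of the series Σ_{n=1}^∞ α_n r_n. Then Y*Y − 1 ∈ B and YY* − 1 ∈ B; that is, Y is unitary modulo B, so the image of Y in the corona algebra 𝓜(B)/B is a unitary. -/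
open scoped MultiplierAlgebra

open Filter Finset Topology

section Algebra

variable {B : Type*} [NonUnitalRing B] {e : ℕ → B}

lemma mul_eq_of_lt_of_succ_mul (h : ∀ n, e (n + 1) * e n = e n) {m n : ℕ} (hmn : m < n) :
    e n * e m = e m := by
  induction n, hmn using Nat.le_induction with
  | base => exact h m
  | succ k _ ih => rw [← ih, ← mul_assoc, h k]

lemma mul_eq_of_lt_of_mul_succ (h : ∀ n, e n * e (n + 1) = e n) {m n : ℕ} (hmn : m < n) :
    e m * e n = e m := by
  induction n, hmn using Nat.le_induction with
  | base => exact h m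
  | succ k _ ih => rw [← ih, mul_assoc, h k]

variable [Module ℂ B]

lemma sum_smul_sub_mul_of_lt [IsScalarTower ℂ B B] (h : ∀ m n, m < n → e m * e n = e m)
    (α : ℕ → ℂ) {N k : ℕ} (hk : N < k) :
    (∑ j ∈ Icc 1 N, α j • (e j - e (j - 1))) * e k = ∑ j ∈ Icc 1 N, α j • (e j - e (j - 1)) := by
  rw [sum_mul]
  refine sum_congr rfl fun j hj => ?_
  have hj' := (mem_Icc.1 hj).2
  rw [smul_mul_assoc, sub_mul, h j k (by lia), h (j - 1) k (by lia)]

lemma mul_sum_smul_sub_of_lt [SMulCommClass ℂ B B] (h : ∀ m n, m < n → e n * e m = e m)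
    (α : ℕ → ℂ) {N k : ℕ} (hk : N < k) :
    e k * (∑ j ∈ Icc 1 N, α j • (e j - e (j - 1))) = ∑ j ∈ Icc 1 N, α j • (e j - e (j - 1)) := by
  rw [mul_sum]
  refine sum_congr rfl fun j hj => ?_
  have hj' := (mem_Icc.1 hj).2
  rw [mul_smul_comm, mul_sub, h j k (by lia), h (j - 1) k (by lia)]

lemma sum_smul_sub_mul_self [IsScalarTower ℂ B B] (he0 : e 0 = 0)
    (h : ∀ m n, m < n → e m * e n = e m) (α : ℕ → ℂ) (N : ℕ) :
    (∑ j ∈ Icc 1 N, α j • (e j - e (j - 1))) * e N =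
      ∑ j ∈ Icc 1 N, α j • (e j - e (j - 1)) - α N • (e N - e N * e N) := by
  cases N with
  | zero => simp [he0]
  | succ k =>
    rw [sum_Icc_succ_top (by lia), add_mul, sum_smul_sub_mul_of_lt h α k.lt_succ_self,
      smul_mul_assoc, Nat.add_sub_cancel, sub_mul, h k (k + 1) k.lt_succ_self]
    module

lemma mul_self_sum_smul_sub [SMulCommClass ℂ B B] (he0 : e 0 = 0)
    (h : ∀ m n, m < n → e n * e m = e m) (α : ℕ → ℂ) (N : ℕ) :
    e N * (∑ j ∈ Icc 1 N, α j • (e j - e (j - 1))) =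
      ∑ j ∈ Icc 1 N, α j • (e j - e (j - 1)) - α N • (e N - e N * e N) := by
  cases N with
  | zero => simp [he0]
  | succ k =>
    rw [sum_Icc_succ_top (by lia), mul_add, mul_sum_smul_sub_of_lt h α k.lt_succ_self,
      mul_smul_comm, Nat.add_sub_cancel, mul_sub, h k (k + 1) k.lt_succ_self]
    module

/-- The product of two partial sums with pointwise inverse coefficients differs from `e N * e N`
by a combination of the elements `e k - e k * e k` whose coefficients only involve differences of
neighbouring coefficients. -/
lemma sum_smul_sub_mul_sum_smul_sub [IsScalarTower ℂ B B] [SMulCommClass ℂ B B]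
    (he0 : e 0 = 0) (hl : ∀ m n, m < n → e n * e m = e m)
    (hr : ∀ m n, m < n → e m * e n = e m) (α β : ℕ → ℂ) (hαβ : ∀ n, β n * α n = 1) (N : ℕ) :
    (∑ j ∈ Icc 1 N, β j • (e j - e (j - 1))) * (∑ j ∈ Icc 1 N, α j • (e j - e (j - 1))) =
      e N * e N - ∑ k ∈ range N,
        ((β (k + 1) - β k) * (α (k + 1) - α k)) • (e k - e k * e k) := by
  induction N with
  | zero => simp [he0]
  | succ N ih =>
    have hT := sum_smul_sub_mul_self he0 hr β N
    have hT' := sum_smul_sub_mul_of_lt hr β N.lt_succ_self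
    have hS := mul_self_sum_smul_sub he0 hl α N
    have hS' := mul_sum_smul_sub_of_lt hl α N.lt_succ_self
    rw [sum_Icc_succ_top (by lia), sum_Icc_succ_top (by lia), Nat.add_sub_cancel,
      sum_range_succ]
    generalize (∑ j ∈ Icc 1 N, β j • (e j - e (j - 1))) = T at *
    generalize (∑ j ∈ Icc 1 N, α j • (e j - e (j - 1))) = S at *
    generalize (∑ k ∈ range N,
      ((β (k + 1) - β k) * (α (k + 1) - α k)) • (e k - e k * e k)) = R at *
    have hc : (β (N + 1) - β N) * (α (N + 1) - α N) =
        2 - β (N + 1) * α N - α (N + 1) * β N := by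
      linear_combination hαβ N + hαβ (N + 1)
    rw [hc]
    simp only [add_mul, mul_add, smul_mul_assoc, mul_smul_comm, mul_sub, sub_mul, ih, hT, hT', hS,
      hS', hl N (N + 1) N.lt_succ_self, hr N (N + 1) N.lt_succ_self]
    linear_combination (norm := module)
      hαβ (N + 1) • (e (N + 1) * e (N + 1) - e N - (e N - e N * e N))

end Algebra

section CStar

variable {B : Type*} [NonUnitalCStarAlgebra B] {e : ℕ → B}

lemma summable_smul_sub_mul_self (hsa : ∀ n, IsSelfAdjoint (e n)) (hnorm : ∀ n, ‖e n‖ ≤ 1)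
    (hl : ∀ m n, m < n → e n * e m = e m) (hr : ∀ m n, m < n → e m * e n = e m) (c : ℕ → ℂ)
    (hcsa : ∀ n, IsSelfAdjoint (c n)) (hc : Tendsto c atTop (𝓝 0)) :
    Summable fun n => c n • (e n - e n * e n) := by
  have hs (n : ℕ) : ‖e n - e n * e n‖ ≤ 2 := by
    have h1 := norm_sub_le (e n) (e n * e n)
    have h2 := norm_mul_le (e n) (e n)
    have h3 := mul_le_one₀ (hnorm n) (norm_nonneg _) (hnorm n)
    linarith [hnorm n]
  have horth : ∀ m n, m < n → (e m - e m * e m) * (e n - e n * e n) = 0 ∧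
      (e n - e n * e n) * (e m - e m * e m) = 0 := by
    intro m n hmn
    have h1 : (e m - e m * e m) * e n = e m - e m * e m := by
      rw [sub_mul, mul_assoc, hr m n hmn]
    have h2 : e n * (e m - e m * e m) = e m - e m * e m := by
      rw [mul_sub, ← mul_assoc, hl m n hmn]
    constructor
    · rw [mul_sub, ← mul_assoc, h1, h1, sub_self]
    · rw [sub_mul, mul_assoc, h2, h2, sub_self]
  rw [summable_iff_vanishing_norm]
  intro ε hε
  obtain ⟨N, hN⟩ := Metric.tendsto_atTop.1 hc (ε / 4) (by positivity)
  refine ⟨range N, fun t ht => ?_⟩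
  have hsum := IsSelfAdjoint.nnnorm_sum_eq_sup (f := fun n => c n • (e n - e n * e n)) t
    (fun n _ => (hcsa n).smul ((hsa n).sub (by
      simpa [(hsa n).star_eq] using IsSelfAdjoint.star_mul_self (e n))))
    (fun m n hmn => by
      rcases lt_or_gt_of_ne hmn with h | h
      · simp [Function.onFun, smul_mul_smul_comm, (horth m n h).1]
      · simp [Function.onFun, smul_mul_smul_comm, (horth n m h).2])
  have hle : ‖∑ n ∈ t, c n • (e n - e n * e n)‖₊ ≤ (ε / 2).toNNReal := by
    rw [hsum]
    refine Finset.sup_le fun n hn => ?_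
    have hn' : N ≤ n := by
      by_contra! hlt
      exact Finset.disjoint_left.1 ht hn (mem_range.2 hlt)
    have hcn : ‖c n‖ ≤ ε / 4 := by simpa using (hN n hn').le
    rw [← NNReal.coe_le_coe, Real.coe_toNNReal _ (by positivity), coe_nnnorm, norm_smul]
    nlinarith [hs n, norm_nonneg (c n), norm_nonneg (e n - e n * e n)]
  rw [← NNReal.coe_le_coe, Real.coe_toNNReal _ (by positivity), coe_nnnorm] at hle
  linarith

end CStar

namespace DoubleCentralizer

variable {B : Type*} [NonUnitalCStarAlgebra B]

lemma coe_mul_coe (a b : B) : ((a * b : B) : 𝓜(ℂ, B)) = (a : 𝓜(ℂ, B)) * (b : 𝓜(ℂ, B)) :=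
  map_mul (coeHom (𝕜 := ℂ) (A := B)) a b

lemma coe_sub (a b : B) : ((a - b : B) : 𝓜(ℂ, B)) = (a : 𝓜(ℂ, B)) - (b : 𝓜(ℂ, B)) :=
  map_sub (coeHom (𝕜 := ℂ) (A := B)) a b

lemma coe_neg (a : B) : ((-a : B) : 𝓜(ℂ, B)) = -(a : 𝓜(ℂ, B)) :=
  map_neg (coeHom (𝕜 := ℂ) (A := B)) a

lemma coe_star (a : B) : ((star a : B) : 𝓜(ℂ, B)) = star (a : 𝓜(ℂ, B)) :=
  map_star (coeHom (𝕜 := ℂ) (A := B)) a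

lemma continuous_coe_s2 : Continuous (fun a : B => (a : 𝓜(ℂ, B))) :=
  AddMonoidHomClass.continuous_of_bound (coeHom (𝕜 := ℂ) (A := B)) 1 fun a => by
    rw [coeHom_apply, ← norm_fst, coe_fst, one_mul]
    exact ContinuousLinearMap.opNorm_mul_apply_le ℂ B a

/-- An element of the multiplier algebra compressed to zero by all elements of `B` vanishes. -/
lemma eq_zero_of_forall_coe_mul_mul_coe {T : 𝓜(ℂ, B)}
    (h : ∀ x y : B, (y : 𝓜(ℂ, B)) * T * (x : 𝓜(ℂ, B)) = 0) : T = 0 := by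
  have hsnd : T.snd = 0 := by
    ext y
    set z := T.snd y with hz
    have h0 : z * (star z * (z * star z)) = 0 := by
      have := congrArg (fun M : 𝓜(ℂ, B) => M.fst (z * star z)) (h (star z) y)
      simpa [← T.central, ← hz] using this
    have h1 : star (z * star z) * (z * star z) = 0 := by
      rwa [star_mul, star_star, mul_assoc]
    simpa using CStarRing.star_mul_self_eq_zero_iff _ |>.1 h1
  rw [← norm_eq_zero, ← norm_snd, hsnd, norm_zero]

/-- A strict limit of products of the form `e n * e n - a n`, with `e` an approximate unit and
`a n → b` in norm, equals `1 - b`. -/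
lemma eq_one_sub_coe_of_tendsto {e a : ℕ → B} {b : B}
    (he : ∀ x : B, Tendsto (fun n => e n * x) atTop (𝓝 x))
    (he' : ∀ x : B, Tendsto (fun n => x * e n) atTop (𝓝 x)) (ha : Tendsto a atTop (𝓝 b))
    {T : 𝓜(ℂ, B)}
    (hT : ∀ x y : B, Tendsto
      (fun n => (y : 𝓜(ℂ, B)) * ((e n * e n - a n : B) : 𝓜(ℂ, B)) * (x : 𝓜(ℂ, B))) atTop
      (𝓝 ((y : 𝓜(ℂ, B)) * T * (x : 𝓜(ℂ, B))))) :
    T - 1 = ((-b : B) : 𝓜(ℂ, B)) := by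
  rw [← sub_eq_zero]
  refine eq_zero_of_forall_coe_mul_mul_coe fun x y => ?_
  have h1 : Tendsto (fun n => y * (e n * e n - a n) * x) atTop (𝓝 (y * x - y * b * x)) := by
    refine (((he' y).mul (he x)).sub ((ha.const_mul y).mul_const x)).congr fun n => ?_
    simp only [mul_sub, sub_mul, mul_assoc]
  have h2 := (continuous_coe_s2.tendsto _).comp h1
  have h3 := tendsto_nhds_unique (hT x y) (h2.congr fun n => by
    simp only [Function.comp_apply, coe_mul_coe])
  rw [mul_sub, mul_sub, sub_mul, sub_mul, h3, coe_neg, coe_sub, coe_mul_coe, coe_mul_coe,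
    coe_mul_coe]
  noncomm_ring

end DoubleCentralizer

/-- let `B` be a nonunital σ-unital simple C*-algebra, `(e n)` an approximate
unit with `e (n+1) * e n = e n` (`e 0 = 0`, `r n := e n - e (n-1)`), and `(α n)` a sequence
on the unit circle with the close neighbors property.  If `Y` is the strict sum of
`Σ α n • r n`, then `star Y * Y - 1 ∈ B` and `Y * star Y - 1 ∈ B`, i.e. `Y` is unitary
modulo `B`. -/
theorem statement_2 {B : Type*} [NonUnitalCStarAlgebra B] [PartialOrder B] [StarOrderedRing B]
    (hnonunital : ¬∃ u : B, ∀ b : B, u * b = b ∧ b * u = b)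
    (hsimple : ∀ I : TwoSidedIdeal B, IsClosed (I : Set B) → I = ⊥ ∨ I = ⊤)
    (e : ℕ → B) (he : IsApproximateUnit e) (he0 : e 0 = 0)
    (hee : ∀ n ≥ 1, e (n + 1) * e n = e n)
    (α : ℕ → ℂ) (hα : ∀ n, ‖α n‖ = 1)
    (hcn : Filter.Tendsto (fun n => ‖α (n + 1) - α n‖) Filter.atTop (nhds 0))
    (Y : 𝓜(ℂ, B)) (hY : StrictlySumsTo (fun n => α n • (e n - e (n - 1))) Y) :
    (∃ b : B, star Y * Y - 1 = (b : 𝓜(ℂ, B))) ∧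
      (∃ b : B, Y * star Y - 1 = (b : 𝓜(ℂ, B))) := by

  obtain ⟨hpos, hnorm, heL, heR⟩ := he
  have hsa (n : ℕ) : IsSelfAdjoint (e n) := .of_nonneg (hpos n)
  have hl1 (n : ℕ) : e (n + 1) * e n = e n := by
    rcases Nat.eq_zero_or_pos n with rfl | hn
    · simp [he0]
    · exact hee n hn
  have hr1 (n : ℕ) : e n * e (n + 1) = e n := by
    simpa [(hsa _).star_eq] using congrArg star (hl1 n)
  have hl (m n : ℕ) (h : m < n) : e n * e m = e m := mul_eq_of_lt_of_succ_mul hl1 h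
  have hr (m n : ℕ) (h : m < n) : e m * e n = e m := mul_eq_of_lt_of_mul_succ hr1 h
  have heL' (x : B) : Tendsto (fun n => e n * x) atTop (𝓝 x) :=
    tendsto_iff_norm_sub_tendsto_zero.2 (heL x)
  have heR' (x : B) : Tendsto (fun n => x * e n) atTop (𝓝 x) :=
    tendsto_iff_norm_sub_tendsto_zero.2 (heR x)
  set β : ℕ → ℂ := fun n => star (α n) with hβ
  have hβα (n : ℕ) : β n * α n = 1 := by
    simp [hβ, Complex.conj_mul', hα n]
  have hαβ (n : ℕ) : α n * β n = 1 := by rw [mul_comm, hβα]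
  set c : ℕ → ℂ := fun n => (β (n + 1) - β n) * (α (n + 1) - α n) with hc
  have hc0 : Tendsto c atTop (𝓝 0) := by
    rw [tendsto_zero_iff_norm_tendsto_zero]
    simpa [hc, hβ, ← map_sub] using hcn.mul hcn
  have hcsa (n : ℕ) : IsSelfAdjoint (c n) := by
    simp only [hc, hβ, ← star_sub]
    exact .star_mul_self _
  have hb := (summable_smul_sub_mul_self hsa hnorm hl hr c hcsa hc0).hasSum.tendsto_sum_nat
  set S : ℕ → B := fun N => ∑ j ∈ Icc 1 N, α j • (e j - e (j - 1)) with hS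
  have hSstar (N : ℕ) : star (S N) = ∑ j ∈ Icc 1 N, β j • (e j - e (j - 1)) := by
    simp [hS, hβ, (hsa _).star_eq]
  have hprod (N : ℕ) : star (S N) * S N =
      e N * e N - ∑ k ∈ range N, c k • (e k - e k * e k) := by
    rw [hSstar, sum_smul_sub_mul_sum_smul_sub he0 hl hr α β hβα]
  have hprod' (N : ℕ) : S N * star (S N) =
      e N * e N - ∑ k ∈ range N, c k • (e k - e k * e k) := by
    rw [hSstar, sum_smul_sub_mul_sum_smul_sub he0 hl hr β α hαβ]
    simp only [hc, mul_comm]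
  refine ⟨⟨_, DoubleCentralizer.eq_one_sub_coe_of_tendsto heL' heR' hb fun x y => ?_⟩,
    ⟨_, DoubleCentralizer.eq_one_sub_coe_of_tendsto heL' heR' hb fun x y => ?_⟩⟩
  · have h := ((hY (star y)).1.star).mul (hY x).1
    simp only [star_mul, DoubleCentralizer.coe_star, star_star] at h
    simp only [← hprod, DoubleCentralizer.coe_mul_coe, DoubleCentralizer.coe_star]
    simpa only [mul_assoc] using h
  · have h := ((hY y).2).mul (hY (star x)).2.star
    simp only [star_mul, DoubleCentralizer.coe_star, star_star] at h
    simp only [← hprod', DoubleCentralizer.coe_mul_coe, DoubleCentralizer.coe_star]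
    simpa only [mul_assoc] using h
end

section
/- Let B be a nonunital σ-unital simple C*-algebra, let S = {x_k : k ≥ 1} ⊆ 𝓜(B) be a countable set, and let (e_n) be an approximate unit for B such that e_{n+1} e_n = e_n for all n ≥ 1 and ‖e_n x_k − x_k e_n‖ < 1/2^n for all n and all 1 ≤ k ≤ n (with e_0 := 0 and r_n := e_n − e_{n−1}). Then for every bounded sequence (α_n) of complex numbers, if Y ∈ 𝓜(B) is the strict sum of the series Σ_{n=1}^∞ α_n r_n, then Y x_k − x_k Y ∈ B for every k; that is, the image of Y in the corona algebra 𝓜(B)/B commutes with the image of every element of S. -/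
open scoped MultiplierAlgebra

namespace DoubleCentralizer

variable {B : Type*} [NonUnitalCStarAlgebra B]

lemma fst_apply_mul (a : 𝓜(ℂ, B)) (b c : B) : a.fst (b * c) = a.fst b * c := by
  rw [← sub_eq_zero, ← CStarRing.star_mul_self_eq_zero_iff]
  generalize star (a.fst (b * c) - a.fst b * c) = d
  rw [mul_sub, ← a.central, ← mul_assoc, ← mul_assoc, ← a.central, sub_self]

lemma snd_apply_mul (a : 𝓜(ℂ, B)) (b c : B) : a.snd (b * c) = b * a.snd c := by
  rw [← sub_eq_zero, ← CStarRing.mul_star_self_eq_zero_iff]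
  generalize star (a.snd (b * c) - b * a.snd c) = d
  rw [sub_mul, a.central, mul_assoc, mul_assoc, a.central, sub_self]

lemma mul_coe (a : 𝓜(ℂ, B)) (b : B) : a * (b : 𝓜(ℂ, B)) = (a.fst b : 𝓜(ℂ, B)) :=
  DoubleCentralizer.ext _ _ _ _ <| Prod.ext
    (ContinuousLinearMap.ext fun c => fst_apply_mul a b c)
    (ContinuousLinearMap.ext fun c => a.central c b)

lemma coe_mul (a : 𝓜(ℂ, B)) (b : B) : (b : 𝓜(ℂ, B)) * a = (a.snd b : 𝓜(ℂ, B)) :=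
  DoubleCentralizer.ext _ _ _ _ <| Prod.ext
    (ContinuousLinearMap.ext fun c => (a.central b c).symm)
    (ContinuousLinearMap.ext fun c => snd_apply_mul a c b)

lemma norm_coe (b : B) : ‖(b : 𝓜(ℂ, B))‖ = ‖b‖ := by
  rw [← norm_fst, coe_fst, ContinuousLinearMap.opNorm_mul_apply]

lemma isClosed_range_coeHom :
    IsClosed (Set.range (coeHom : B →⋆ₙₐ[ℂ] 𝓜(ℂ, B))) :=
  (AddMonoidHomClass.isometry_of_norm (coeHom : B →⋆ₙₐ[ℂ] 𝓜(ℂ, B)) norm_coe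
    ).isClosedEmbedding.isClosed_range

/-- `B` is essential in its multiplier algebra: multipliers are separated by `B`. -/
lemma eq_of_forall_mul_coe_eq {a a' : 𝓜(ℂ, B)}
    (h : ∀ b : B, a * (b : 𝓜(ℂ, B)) = a' * (b : 𝓜(ℂ, B))) : a = a' := by
  have hfst : (a - a').fst = 0 := by
    ext b
    have hb := h b
    rw [← sub_eq_zero, ← sub_mul, mul_coe] at hb
    rw [zero_apply, ← norm_eq_zero, ← norm_coe, hb, norm_zero]
  rw [← sub_eq_zero, ← norm_eq_zero, ← norm_fst, hfst, norm_zero]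

end DoubleCentralizer

/-- let `B` be a nonunital σ-unital simple C*-algebra,
`S = {x k : k ≥ 1} ⊆ 𝓜(B)` countable, and `(e n)` an approximate unit with
`e (n+1) * e n = e n` and `‖e n * x k - x k * e n‖ < 1 / 2 ^ n` for `1 ≤ k ≤ n`
(`e 0 = 0`, `r n := e n - e (n-1)`).  For every bounded sequence `(α n)` of complex
numbers, if `Y` is the strict sum of `Σ α n • r n`, then `Y * x k - x k * Y ∈ B`
for every `k ≥ 1`. -/
theorem statement_4 {B : Type*} [NonUnitalCStarAlgebra B] [PartialOrder B] [StarOrderedRing B]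
    (hnonunital : ¬∃ u : B, ∀ b : B, u * b = b ∧ b * u = b)
    (hsimple : ∀ I : TwoSidedIdeal B, IsClosed (I : Set B) → I = ⊥ ∨ I = ⊤)
    (x : ℕ → 𝓜(ℂ, B))
    (e : ℕ → B) (he : IsApproximateUnit e) (he0 : e 0 = 0)
    (hee : ∀ n ≥ 1, e (n + 1) * e n = e n)
    (hqc : ∀ n ≥ 1, ∀ k, 1 ≤ k → k ≤ n →
      ‖(e n : 𝓜(ℂ, B)) * x k - x k * (e n : 𝓜(ℂ, B))‖ < 1 / 2 ^ n)
    (α : ℕ → ℂ) (hα : ∃ C : ℝ, ∀ n, ‖α n‖ ≤ C)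
    (Y : 𝓜(ℂ, B)) (hY : StrictlySumsTo (fun n => α n • (e n - e (n - 1))) Y) :
    ∀ k ≥ 1, ∃ b : B, Y * x k - x k * Y = (b : 𝓜(ℂ, B)) := by
  intro k hk
  obtain ⟨C, hC⟩ := hα
  have hC0 : 0 ≤ C := (norm_nonneg _).trans (hC 0)
  let φ : B →⋆ₙₐ[ℂ] 𝓜(ℂ, B) := DoubleCentralizer.coeHom
  let d : ℕ → 𝓜(ℂ, B) := fun j =>
    φ (α j • (e j - e (j - 1))) * x k - x k * φ (α j • (e j - e (j - 1)))
  have hd_range (j : ℕ) : d j ∈ NonUnitalStarAlgHom.range φ := by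
    refine sub_mem ⟨_, (DoubleCentralizer.coe_mul (x k) _).symm⟩
      ⟨_, (DoubleCentralizer.mul_coe (x k) _).symm⟩
  have hd_zero : d 0 = 0 := by simp [d]
  have hd_eq (j : ℕ) : d j = α j • ((φ (e j) * x k - x k * φ (e j))
      - (φ (e (j - 1)) * x k - x k * φ (e (j - 1)))) := by
    simp only [d, map_smul, map_sub, smul_mul_assoc, mul_smul_comm, ← smul_sub, sub_mul, mul_sub]
    congr 1
    abel
  have hd_summable : Summable d := by
    refine Summable.of_norm_bounded_eventually_nat
      ((summable_geometric_two).mul_left (C * 3)) ?_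
    filter_upwards [Filter.eventually_ge_atTop (k + 1)] with j hj
    obtain ⟨m, rfl⟩ : ∃ m, j = m + 1 := ⟨j - 1, by omega⟩
    have h1 : ‖φ (e (m + 1)) * x k - x k * φ (e (m + 1))‖ < 1 / 2 ^ (m + 1) :=
      hqc (m + 1) (by omega) k hk (by omega)
    have h2 : ‖φ (e m) * x k - x k * φ (e m)‖ < 1 / 2 ^ m :=
      hqc m (by omega) k hk (by omega)
    rw [hd_eq, norm_smul, mul_assoc, Nat.add_sub_cancel]
    refine mul_le_mul (hC _) ((norm_sub_le _ _).trans ((add_le_add h1.le h2.le).trans_eq ?_))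
      (norm_nonneg _) hC0
    rw [one_div_pow, pow_succ]
    field_simp
    norm_num
  have hd_tendsto := (hd_summable.hasSum.tendsto_sum_nat).comp (Filter.tendsto_add_atTop_nat 1)
  have hS_range : (∑' j, d j) ∈ Set.range φ :=
    DoubleCentralizer.isClosed_range_coeHom.mem_of_tendsto hd_tendsto
      (Filter.Eventually.of_forall fun _ =>
        sum_mem fun j _ => hd_range j)
  have hd_sum (N : ℕ) : ∑ j ∈ Finset.range (N + 1), d j =
      φ (∑ j ∈ Finset.Icc 1 N, α j • (e j - e (j - 1))) * x k
        - x k * φ (∑ j ∈ Finset.Icc 1 N, α j • (e j - e (j - 1))) := by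
    rw [map_sum, Finset.sum_mul, Finset.mul_sum, ← Finset.sum_sub_distrib,
      Finset.range_eq_Ico, Finset.sum_eq_sum_Ico_succ_bot (Nat.succ_pos N), hd_zero, zero_add]
    rfl
  obtain ⟨b, hb⟩ := hS_range
  refine ⟨b, Eq.trans ?_ hb.symm⟩
  refine DoubleCentralizer.eq_of_forall_mul_coe_eq fun c => ?_
  have hlim := hd_tendsto.mul_const (c : 𝓜(ℂ, B))
  have hlim' := (hY ((x k).fst c)).1.sub ((hY c).1.const_mul (x k))
  rw [← DoubleCentralizer.mul_coe, ← mul_assoc, ← mul_assoc, ← sub_mul] at hlim'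
  refine tendsto_nhds_unique (hlim'.congr fun N => ?_) hlim
  rw [Function.comp_apply, hd_sum, sub_mul, mul_assoc, mul_assoc]
  rfl
end

section
/- (Property B) Let B be a nonunital σ-unital simple C*-algebra and let (e_n) be an approximate unit for B satisfying e_{n+1} e_n = e_n for all n ≥ 1 (with e_0 := 0 and r_n := e_n − e_{n−1}). For every Laurent polynomial h, every contractive X ∈ 𝓜(B), every ε > 0 and every y ∈ B, there exists M ≥ 1 such that: for all sequences (α_j) and (α'_j) in the closed unit ball of ℂ with α_j = α'_j for all j ≤ M, if Y and Y' are the strict sums of Σ_{j=1}^∞ α_j r_j and Σ_{j=1}^∞ α'_j r_j respectively, then ‖h(Y X)·y − h(Y' X)·y‖ < ε. -/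
open scoped MultiplierAlgebra

/-- Evaluation of the Laurent polynomial
`h(λ) = Σ_{n=0}^{N} β n λ^n + Σ_{m=1}^{M} γ m λ̄^m` at an element `x` of a unital
complex star algebra: `h(x) = Σ_{n=0}^{N} β n • x^n + Σ_{m=1}^{M} γ m • (x⋆)^m`. -/
def laurentEval {A : Type*} [Ring A] [StarRing A] [Module ℂ A]
    (N M : ℕ) (β γ : ℕ → ℂ) (x : A) : A :=
  (∑ n ∈ Finset.range (N + 1), β n • x ^ n) + ∑ m ∈ Finset.Icc 1 M, γ m • star x ^ m

/-- The span of the vector-valued functions `i ↦ φ i • b`, where `φ` is a scalar function bounded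
by one that is constant along one of the relations `R M`. -/
def cylinderFunctions {ι : Type*} (E : Type*) [NormedAddCommGroup E] [NormedSpace ℂ E]
    (R : ℕ → ι → ι → Prop) : Submodule ℂ (ι → E) :=
  Submodule.span ℂ {F | ∃ φ : ι → ℂ, (∀ i, ‖φ i‖ ≤ 1) ∧
    (∃ M, ∀ i j, R M i j → φ i = φ j) ∧ ∃ b : E, F = fun i => φ i • b}

/-- The functions that are uniform limits of elements of `cylinderFunctions E R`. -/
def almostCylinderFunctions {ι : Type*} (E : Type*) [NormedAddCommGroup E] [NormedSpace ℂ E]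
    (R : ℕ → ι → ι → Prop) : Submodule ℂ (ι → E) where
  carrier := {F | ∀ ε > 0, ∃ G ∈ cylinderFunctions E R, ∀ i, ‖F i - G i‖ ≤ ε}
  zero_mem' := fun ε hε => ⟨0, Submodule.zero_mem _, fun i => by simpa using hε.le⟩
  add_mem' := by
    intro F F' hF hF' ε hε
    obtain ⟨G, hG, h⟩ := hF (ε / 2) (half_pos hε)
    obtain ⟨G', hG', h'⟩ := hF' (ε / 2) (half_pos hε)
    refine ⟨G + G', Submodule.add_mem _ hG hG', fun i => ?_⟩
    calc ‖(F + F') i - (G + G') i‖ = ‖(F i - G i) + (F' i - G' i)‖ := by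
          simp only [Pi.add_apply]; congr 1; abel
      _ ≤ ‖F i - G i‖ + ‖F' i - G' i‖ := norm_add_le _ _
      _ ≤ ε := by linarith [h i, h' i]
  smul_mem' := by
    intro c F hF ε hε
    obtain ⟨G, hG, h⟩ := hF (ε / (‖c‖ + 1)) (by positivity)
    refine ⟨c • G, Submodule.smul_mem _ c hG, fun i => ?_⟩
    calc ‖(c • F) i - (c • G) i‖ = ‖c‖ * ‖F i - G i‖ := by
          rw [Pi.smul_apply, Pi.smul_apply, ← smul_sub, norm_smul]
      _ ≤ (‖c‖ + 1) * (ε / (‖c‖ + 1)) := by gcongr; exacts [by linarith, h i]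
      _ = ε := by field_simp

section CylinderFunctions

variable {ι E : Type*} [NormedAddCommGroup E] [NormedSpace ℂ E] {R : ℕ → ι → ι → Prop}

lemma cylinderFunctions_le_almostCylinderFunctions :
    cylinderFunctions E R ≤ almostCylinderFunctions E R :=
  fun F hF ε hε => ⟨F, hF, fun i => by simpa using hε.le⟩

lemma mem_almostCylinderFunctions_of_forall_close {F : ι → E}
    (hF : ∀ ε > 0, ∃ G ∈ almostCylinderFunctions E R, ∀ i, ‖F i - G i‖ ≤ ε) :
    F ∈ almostCylinderFunctions E R := by
  intro ε hε
  obtain ⟨G, hG, h⟩ := hF (ε / 2) (half_pos hε)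
  obtain ⟨H, hH, h'⟩ := hG (ε / 2) (half_pos hε)
  exact ⟨H, hH, fun i => (norm_sub_le_norm_sub_add_norm_sub _ (G i) _).trans
    (by linarith [h i, h' i])⟩

lemma const_mem_almostCylinderFunctions (b : E) :
    (fun _ => b) ∈ almostCylinderFunctions E R :=
  cylinderFunctions_le_almostCylinderFunctions
    (Submodule.subset_span ⟨fun _ => 1, by simp, ⟨0, by simp⟩, b, by simp⟩)

/-- Multiplication by an admissible scalar function preserves almost cylinder functions. -/
lemma smul_mem_almostCylinderFunctions (hR : ∀ M N, M ≤ N → ∀ i j, R N i j → R M i j)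
    {φ : ι → ℂ} (hφ : ∀ i, ‖φ i‖ ≤ 1)
    (hφR : ∃ M, ∀ i j, R M i j → φ i = φ j) {F : ι → E} (hF : F ∈ almostCylinderFunctions E R) :
    (fun i => φ i • F i) ∈ almostCylinderFunctions E R := by
  intro ε hε
  obtain ⟨G, hG, h⟩ := hF ε hε
  refine ⟨fun i => φ i • G i, ?_, fun i => ?_⟩
  · clear h
    induction hG using Submodule.span_induction with
    | mem G hG =>
      obtain ⟨ψ, hψ, ⟨M, hM⟩, b, rfl⟩ := hG
      obtain ⟨N, hN⟩ := hφR
      refine Submodule.subset_span ⟨fun i => φ i * ψ i, fun i => ?_, ⟨max N M, fun i j hij => ?_⟩,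
        b, by simp [mul_smul]⟩
      · rw [norm_mul]
        exact mul_le_one₀ (hφ i) (norm_nonneg _) (hψ i)
      · simp only [hN i j (hR _ _ (le_max_left _ _) i j hij),
          hM i j (hR _ _ (le_max_right _ _) i j hij)]
    | zero => simp only [Pi.zero_apply, smul_zero]; exact (cylinderFunctions E R).zero_mem
    | add G G' _ _ h h' => simpa using! Submodule.add_mem _ h h'
    | smul c G _ h =>
      convert! Submodule.smul_mem _ c h using 1
      ext i
      exact smul_comm _ _ _
  · rw [← smul_sub, norm_smul]
    exact (mul_le_of_le_one_left (norm_nonneg _) (hφ i)).trans (h i)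

/-- A uniformly bounded family of operators whose orbit maps are almost cylinder functions
acts on almost cylinder functions. -/
lemma apply_mem_almostCylinderFunctions (hR : ∀ M N, M ≤ N → ∀ i j, R N i j → R M i j)
    {T : ι → E →L[ℂ] E} {C : ℝ} (hC : ∀ i, ‖T i‖ ≤ C)
    (hT : ∀ z, (fun i => T i z) ∈ almostCylinderFunctions E R)
    {F : ι → E} (hF : F ∈ almostCylinderFunctions E R) :
    (fun i => T i (F i)) ∈ almostCylinderFunctions E R := by
  refine mem_almostCylinderFunctions_of_forall_close fun ε hε => ?_
  obtain ⟨G, hG, h⟩ := hF (ε / (|C| + 1)) (by positivity)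
  refine ⟨fun i => T i (G i), ?_, fun i => ?_⟩
  · clear h
    induction hG using Submodule.span_induction with
    | mem G hG =>
      obtain ⟨ψ, hψ, hM, b, rfl⟩ := hG
      simpa using smul_mem_almostCylinderFunctions hR hψ hM (hT b)
    | zero => simp only [Pi.zero_apply, map_zero]; exact (almostCylinderFunctions E R).zero_mem
    | add G G' _ _ h h' => simpa using! Submodule.add_mem _ h h'
    | smul c G _ h => simpa using! Submodule.smul_mem _ c h
  · rw [← map_sub]
    calc ‖T i (F i - G i)‖ ≤ ‖T i‖ * ‖F i - G i‖ := (T i).le_opNorm _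
      _ ≤ (|C| + 1) * (ε / (|C| + 1)) := by
        gcongr
        exacts [by linarith [hC i, le_abs_self C], h i]
      _ = ε := by field_simp

lemma pow_apply_mem_almostCylinderFunctions (hR : ∀ M N, M ≤ N → ∀ i j, R N i j → R M i j)
    {T : ι → E →L[ℂ] E} {C : ℝ} (hC : ∀ i, ‖T i‖ ≤ C)
    (hT : ∀ z, (fun i => T i z) ∈ almostCylinderFunctions E R) (n : ℕ) (z : E) :
    (fun i => (T i ^ n) z) ∈ almostCylinderFunctions E R := by
  induction n with
  | zero => simpa using const_mem_almostCylinderFunctions z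
  | succ n ih =>
    simpa [pow_succ'] using apply_mem_almostCylinderFunctions hR hC hT ih

lemma exists_norm_sub_lt_of_mem_almostCylinderFunctions
    (hR : ∀ M N, M ≤ N → ∀ i j, R N i j → R M i j) {F : ι → E}
    (hF : F ∈ almostCylinderFunctions E R) {ε : ℝ} (hε : 0 < ε) :
    ∃ M, ∀ i j, R M i j → ‖F i - F j‖ < ε := by
  obtain ⟨G, hG, h⟩ := hF (ε / 3) (by positivity)
  have key : ∃ M, ∀ i j, R M i j → G i = G j := by
    clear h
    induction hG using Submodule.span_induction with
    | mem G hG =>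
      obtain ⟨ψ, hψ, ⟨M, hM⟩, b, rfl⟩ := hG
      exact ⟨M, fun i j hij => by simp only [hM i j hij]⟩
    | zero => exact ⟨0, by simp⟩
    | add G G' _ _ h h' =>
      obtain ⟨M, hM⟩ := h
      obtain ⟨N, hN⟩ := h'
      exact ⟨max M N, fun i j hij => by
        rw [Pi.add_apply, Pi.add_apply, hM i j (hR _ _ (le_max_left _ _) i j hij),
          hN i j (hR _ _ (le_max_right _ _) i j hij)]⟩
    | smul c G _ h =>
      obtain ⟨M, hM⟩ := h
      exact ⟨M, fun i j hij => by rw [Pi.smul_apply, Pi.smul_apply, hM i j hij]⟩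
  obtain ⟨M, hM⟩ := key
  refine ⟨M, fun i j hij => ?_⟩
  have hij' : ‖F i - F j‖ ≤ ‖F i - G i‖ + ‖G i - F j‖ := norm_sub_le_norm_sub_add_norm_sub _ _ _
  rw [hM i j hij, norm_sub_rev (G j)] at hij'
  have := h i
  rw [hM i j hij] at this
  linarith [h j]

end CylinderFunctions

section Multiplier

variable {B : Type*} [NonUnitalCStarAlgebra B]

lemma DoubleCentralizer.norm_coe_s7 (b : B) : ‖(b : 𝓜(ℂ, B))‖ = ‖b‖ := by
  rw [← DoubleCentralizer.norm_fst, DoubleCentralizer.coe_fst]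
  exact ContinuousLinearMap.opNorm_mul_apply ℂ B b

lemma DoubleCentralizer.mul_coe_s7 (a : 𝓜(ℂ, B)) (b : B) : a * (b : 𝓜(ℂ, B)) = (a.fst b : B) := by
  refine DoubleCentralizer.ext _ _ _ _ (Prod.ext ?_ ?_)
  · ext x
    change a.fst (b * x) = a.fst b * x
    have h : ∀ y, y * (a.fst (b * x) - a.fst b * x) = 0 := fun y => by
      rw [mul_sub, ← a.central, ← mul_assoc, ← mul_assoc, ← a.central, sub_self]
    exact sub_eq_zero.1 (CStarRing.star_mul_self_eq_zero_iff _ |>.1 (h (star _)))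
  · ext x
    exact a.central x b

lemma StrictlySumsTo.tendsto_fst {b : ℕ → B} {Y : 𝓜(ℂ, B)} (hY : StrictlySumsTo b Y) (z : B) :
    Filter.Tendsto (fun N => (∑ j ∈ Finset.Icc 1 N, b j) * z) Filter.atTop (nhds (Y.fst z)) := by
  have h := (hY z).1
  rw [tendsto_iff_norm_sub_tendsto_zero] at h ⊢
  refine h.congr fun N => ?_
  rw [← sub_mul, DoubleCentralizer.mul_coe_s7, DoubleCentralizer.norm_coe_s7,
    DoubleCentralizer.sub_fst, sub_apply, DoubleCentralizer.coe_fst,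
    ContinuousLinearMap.mul_apply']

lemma StrictlySumsTo.star {b : ℕ → B} {Y : 𝓜(ℂ, B)} (hY : StrictlySumsTo b Y) :
    StrictlySumsTo (fun j => star (b j)) (star Y) := by
  have hcoe : ∀ a : B, (↑(Star.star a) : 𝓜(ℂ, B)) = Star.star (a : 𝓜(ℂ, B)) :=
    fun a => map_star (DoubleCentralizer.coeHom (𝕜 := ℂ) (A := B)) a
  intro x
  obtain ⟨h1, h2⟩ := hY (Star.star x)
  refine ⟨?_, ?_⟩
  · simpa [← star_sum, hcoe] using h2.star
  · simpa [← star_sum, hcoe] using h1.star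

end Multiplier

section ApproximateUnit

variable {B : Type*} [NonUnitalCStarAlgebra B] [PartialOrder B] [StarOrderedRing B]

lemma CStarAlgebra.mul_self_le_self_of_norm_le_one {b : B} (hb : 0 ≤ b) (hb1 : ‖b‖ ≤ 1) :
    b * b ≤ b := by
  have hs : IsSelfAdjoint (CFC.sqrt b) := (CFC.sqrt_nonneg b).isSelfAdjoint
  have hss : CFC.sqrt b * CFC.sqrt b = b := CFC.sqrt_mul_sqrt_self b
  have h := CStarAlgebra.star_left_conjugate_le_norm_smul (a := CFC.sqrt b) (b := b)
    hb.isSelfAdjoint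
  rw [hs.star_eq, hss] at h
  have hbb : CFC.sqrt b * b * CFC.sqrt b = b * b := by
    calc CFC.sqrt b * b * CFC.sqrt b
        = CFC.sqrt b * (CFC.sqrt b * CFC.sqrt b) * CFC.sqrt b := by rw [hss]
      _ = (CFC.sqrt b * CFC.sqrt b) * (CFC.sqrt b * CFC.sqrt b) := by simp only [mul_assoc]
      _ = b * b := by rw [hss]
  rw [hbb] at h
  exact h.trans (smul_le_of_le_one_left hb hb1)

lemma CStarAlgebra.le_of_mul_eq_right {a b : B} (ha : 0 ≤ a) (ha1 : ‖a‖ ≤ 1) (hb : 0 ≤ b)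
    (hb1 : ‖b‖ ≤ 1) (h : b * a = a) : a ≤ b := by
  have h' : a * b = a := by
    simpa [ha.isSelfAdjoint.star_eq, hb.isSelfAdjoint.star_eq] using congrArg star h
  have h1 := CStarAlgebra.star_left_conjugate_le_norm_smul (a := b) (b := a) ha.isSelfAdjoint
  rw [hb.isSelfAdjoint.star_eq, h, h'] at h1
  refine h1.trans ((smul_le_of_le_one_left ?_ ha1).trans
    (CStarAlgebra.mul_self_le_self_of_norm_le_one hb hb1))
  simpa [hb.isSelfAdjoint.star_eq] using star_mul_self_nonneg b

variable {e : ℕ → B}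

lemma sum_Icc_sub_pred {G : Type*} [AddCommGroup G] {e : ℕ → G} (he0 : e 0 = 0) (N : ℕ) :
    ∑ j ∈ Finset.Icc 1 N, (e j - e (j - 1)) = e N := by
  induction N with
  | zero => simp [he0]
  | succ n ih => rw [Finset.sum_Icc_succ_top (by omega), ih]; simp

lemma IsApproximateUnit.sub_pred_nonneg (he : IsApproximateUnit e) (he0 : e 0 = 0)
    (hee : ∀ n ≥ 1, e (n + 1) * e n = e n) (j : ℕ) : 0 ≤ e j - e (j - 1) := by
  rcases j with _ | _ | n
  · simp
  · simpa [he0] using he.1 1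
  · exact sub_nonneg.2 (CStarAlgebra.le_of_mul_eq_right (he.1 _) (he.2.1 _) (he.1 _) (he.2.1 _)
      (hee (n + 1) (by omega)))

lemma IsApproximateUnit.norm_sum_real_smul_le (he : IsApproximateUnit e) (he0 : e 0 = 0)
    (hee : ∀ n ≥ 1, e (n + 1) * e n = e n) {c : ℕ → ℝ} (hc0 : ∀ j, 0 ≤ c j) (hc1 : ∀ j, c j ≤ 1)
    (N : ℕ) : ‖∑ j ∈ Finset.Icc 1 N, c j • (e j - e (j - 1))‖ ≤ 1 := by
  refine le_trans (CStarAlgebra.norm_le_norm_of_nonneg_of_le ?_ ?_) (he.2.1 N)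
  · exact Finset.sum_nonneg fun j _ => smul_nonneg (hc0 j) (he.sub_pred_nonneg he0 hee j)
  · rw [← sum_Icc_sub_pred he0 N]
    exact Finset.sum_le_sum fun j _ =>
      smul_le_of_le_one_left (he.sub_pred_nonneg he0 hee j) (hc1 j)

lemma IsApproximateUnit.norm_sum_smul_le (he : IsApproximateUnit e) (he0 : e 0 = 0)
    (hee : ∀ n ≥ 1, e (n + 1) * e n = e n) {α : ℕ → ℂ} (hα : ∀ j, ‖α j‖ ≤ 1) (N : ℕ) :
    ‖∑ j ∈ Finset.Icc 1 N, α j • (e j - e (j - 1))‖ ≤ 6 := by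
  have hre j := abs_le.1 ((Complex.abs_re_le_norm (α j)).trans (hα j))
  have him j := abs_le.1 ((Complex.abs_im_le_norm (α j)).trans (hα j))
  have h1 := he.norm_sum_real_smul_le he0 hee (c := fun j => (1 + (α j).re) / 2)
    (fun j => by linarith [(hre j).1]) (fun j => by linarith [(hre j).2]) N
  have h2 := he.norm_sum_real_smul_le he0 hee (c := fun j => (1 + (α j).im) / 2)
    (fun j => by linarith [(him j).1]) (fun j => by linarith [(him j).2]) N
  set P := ∑ j ∈ Finset.Icc 1 N, ((1 + (α j).re) / 2) • (e j - e (j - 1)) with hP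
  set Q := ∑ j ∈ Finset.Icc 1 N, ((1 + (α j).im) / 2) • (e j - e (j - 1)) with hQ
  have hsum : ∑ j ∈ Finset.Icc 1 N, α j • (e j - e (j - 1)) =
      (2 : ℂ) • P + (2 * Complex.I) • Q - (1 + Complex.I) • e N := by
    rw [hP, hQ, ← sum_Icc_sub_pred he0 N, Finset.smul_sum, Finset.smul_sum, Finset.smul_sum,
      ← Finset.sum_add_distrib, ← Finset.sum_sub_distrib]
    refine Finset.sum_congr rfl fun j _ => ?_
    rw [← Complex.coe_smul ((1 + (α j).re) / 2), ← Complex.coe_smul ((1 + (α j).im) / 2), smul_smul,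
      smul_smul, ← add_smul, ← sub_smul]
    congr 1
    conv_lhs => rw [← Complex.re_add_im (α j)]
    push_cast
    ring
  rw [hsum]
  have hI : ‖(1 + Complex.I : ℂ)‖ ≤ 2 := (norm_add_le _ _).trans (by norm_num)
  calc ‖(2 : ℂ) • P + (2 * Complex.I) • Q - (1 + Complex.I) • e N‖
      ≤ ‖(2 : ℂ) • P‖ + ‖(2 * Complex.I) • Q‖ + ‖(1 + Complex.I) • e N‖ :=
        (norm_sub_le _ _).trans (by gcongr; exact norm_add_le _ _)
    _ = 2 * ‖P‖ + 2 * ‖Q‖ + ‖(1 + Complex.I : ℂ)‖ * ‖e N‖ := by simp [norm_smul]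
    _ ≤ 2 * 1 + 2 * 1 + 2 * 1 := by gcongr; exact he.2.1 N
    _ = 6 := by norm_num

lemma mul_eq_right_of_lt {S : Type*} [Semigroup S] {e : ℕ → S}
    (hee : ∀ n ≥ 1, e (n + 1) * e n = e n) {k m : ℕ} (hk : 1 ≤ k)
    (hkm : k < m) : e m * e k = e k := by
  induction m, hkm using Nat.le_induction with
  | base => exact hee k hk
  | succ m hm ih => rw [← ih, ← mul_assoc, hee m (by omega)]

lemma IsApproximateUnit.norm_fst_le (he : IsApproximateUnit e) (he0 : e 0 = 0)
    (hee : ∀ n ≥ 1, e (n + 1) * e n = e n) {α : ℕ → ℂ} (hα : ∀ j, ‖α j‖ ≤ 1) {Y : 𝓜(ℂ, B)}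
    (hY : StrictlySumsTo (fun j => α j • (e j - e (j - 1))) Y) : ‖Y.fst‖ ≤ 6 := by
  refine Y.fst.opNorm_le_bound (by norm_num) fun z => ?_
  refine le_of_tendsto (hY.tendsto_fst z).norm (Filter.Eventually.of_forall fun N => ?_)
  exact (norm_mul_le _ _).trans (by gcongr; exact he.norm_sum_smul_le he0 hee hα N)

/-- The partial sums converge strictly, uniformly in the coefficients. -/
lemma IsApproximateUnit.exists_forall_norm_fst_sub_sum_le (he : IsApproximateUnit e)
    (he0 : e 0 = 0) (hee : ∀ n ≥ 1, e (n + 1) * e n = e n) (z : B) {ε : ℝ} (hε : 0 < ε) :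
    ∃ N, ∀ α : ℕ → ℂ, (∀ j, ‖α j‖ ≤ 1) → ∀ Y : 𝓜(ℂ, B),
      StrictlySumsTo (fun j => α j • (e j - e (j - 1))) Y →
      ‖Y.fst z - (∑ j ∈ Finset.Icc 1 N, α j • (e j - e (j - 1))) * z‖ ≤ ε := by
  obtain ⟨k, hk, hk1⟩ := (((he.2.2.1 z).eventually
    (gt_mem_nhds (show 0 < ε / 12 by positivity))).and (Filter.eventually_ge_atTop 1)).exists
  refine ⟨k + 1, fun α hα Y hY => ?_⟩
  set S := ∑ j ∈ Finset.Icc 1 (k + 1), α j • (e j - e (j - 1)) with hS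
  have hYe : Y.fst (e k * z) = S * (e k * z) := by
    refine tendsto_nhds_unique (hY.tendsto_fst (e k * z)) (tendsto_const_nhds.congr' ?_)
    filter_upwards [Filter.eventually_ge_atTop (k + 1)] with N hN
    induction N, hN using Nat.le_induction with
    | base => rfl
    | succ N hN ih =>
      rw [Finset.sum_Icc_succ_top (by omega), add_mul, ← ih, smul_mul_assoc, ← mul_assoc (_ - _),
        sub_mul, mul_eq_right_of_lt hee hk1 (by omega), Nat.add_sub_cancel,
        mul_eq_right_of_lt hee hk1 (by omega), sub_self, zero_mul, smul_zero, add_zero]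
  have hsplit : Y.fst z - S * z = S * (e k * z - z) - Y.fst (e k * z - z) := by
    rw [map_sub, hYe, mul_sub]; abel
  rw [hsplit]
  calc ‖S * (e k * z - z) - Y.fst (e k * z - z)‖
      ≤ ‖S‖ * ‖e k * z - z‖ + ‖Y.fst‖ * ‖e k * z - z‖ :=
        (norm_sub_le _ _).trans (add_le_add (norm_mul_le _ _) (Y.fst.le_opNorm _))
    _ ≤ 6 * (ε / 12) + 6 * (ε / 12) := by
        gcongr
        exacts [he.norm_sum_smul_le he0 hee hα _, he.norm_fst_le he0 hee hα hY]
    _ = ε := by ring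

lemma IsApproximateUnit.fst_apply_mem_almostCylinderFunctions (he : IsApproximateUnit e)
    (he0 : e 0 = 0) (hee : ∀ n ≥ 1, e (n + 1) * e n = e n) {ι : Type*} {R : ℕ → ι → ι → Prop}
    {α : ι → ℕ → ℂ} (hα : ∀ i j, ‖α i j‖ ≤ 1)
    (hαR : ∀ k, ∃ M, ∀ i j, R M i j → α i k = α j k) {Y : ι → 𝓜(ℂ, B)}
    (hY : ∀ i, StrictlySumsTo (fun j => α i j • (e j - e (j - 1))) (Y i)) (z : B) :
    (fun i => (Y i).fst z) ∈ almostCylinderFunctions B R := by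
  refine mem_almostCylinderFunctions_of_forall_close fun ε hε => ?_
  obtain ⟨N, hN⟩ := he.exists_forall_norm_fst_sub_sum_le he0 hee z hε
  refine ⟨_, ?_, fun i => hN (α i) (hα i) (Y i) (hY i)⟩
  have hsum : (fun i => (∑ j ∈ Finset.Icc 1 N, α i j • (e j - e (j - 1))) * z) =
      ∑ j ∈ Finset.Icc 1 N, fun i => α i j • ((e j - e (j - 1)) * z) := by
    ext i
    simp [Finset.sum_mul, smul_mul_assoc]
  rw [hsum]
  exact Submodule.sum_mem _ fun j _ => cylinderFunctions_le_almostCylinderFunctions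
    (Submodule.subset_span ⟨fun i => α i j, fun i => hα i j, hαR j, _, rfl⟩)

end ApproximateUnit

lemma laurentEval_fst_apply {B : Type*} [NonUnitalCStarAlgebra B] (N M : ℕ) (β γ : ℕ → ℂ)
    (a : 𝓜(ℂ, B)) (z : B) :
    (laurentEval N M β γ a).fst z =
      ∑ n ∈ Finset.range (N + 1), β n • (a.fst ^ n) z +
        ∑ m ∈ Finset.Icc 1 M, γ m • ((star a).fst ^ m) z := by
  have hsum : ∀ (s : Finset ℕ) (f : ℕ → 𝓜(ℂ, B)), (∑ n ∈ s, f n).fst = ∑ n ∈ s, (f n).fst := by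
    intro s f
    induction s using Finset.induction_on with
    | empty => simp
    | insert a s ha ih => simp [Finset.sum_insert ha, ih]
  simp [laurentEval, hsum]

/-- Property B: for every Laurent polynomial `h`, every contractive
`X ∈ 𝓜(B)`, every `ε > 0` and every `y ∈ B`, there is `M ≥ 1` such that for all
coefficient sequences in the closed unit ball of `ℂ` agreeing up to `M`, the
corresponding strict sums `Y`, `Y'` satisfy
`‖h(Y * X) * y - h(Y' * X) * y‖ < ε`. -/
theorem statement_7 {B : Type*} [NonUnitalCStarAlgebra B] [PartialOrder B] [StarOrderedRing B]
    (hnonunital : ¬∃ u : B, ∀ b : B, u * b = b ∧ b * u = b)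
    (hsimple : ∀ I : TwoSidedIdeal B, IsClosed (I : Set B) → I = ⊥ ∨ I = ⊤)
    (e : ℕ → B) (he : IsApproximateUnit e) (he0 : e 0 = 0)
    (hee : ∀ n ≥ 1, e (n + 1) * e n = e n)
    (Nh Mh : ℕ) (β γ : ℕ → ℂ)
    (X : 𝓜(ℂ, B)) (hX : ‖X‖ ≤ 1)
    (ε : ℝ) (hε : 0 < ε) (y : B) :
    ∃ M ≥ 1, ∀ α α' : ℕ → ℂ, (∀ j, ‖α j‖ ≤ 1) → (∀ j, ‖α' j‖ ≤ 1) →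
      (∀ j ≤ M, α j = α' j) →
      ∀ Y Y' : 𝓜(ℂ, B),
        StrictlySumsTo (fun j => α j • (e j - e (j - 1))) Y →
        StrictlySumsTo (fun j => α' j • (e j - e (j - 1))) Y' →
        ‖laurentEval Nh Mh β γ (Y * X) * (y : 𝓜(ℂ, B)) -
          laurentEval Nh Mh β γ (Y' * X) * (y : 𝓜(ℂ, B))‖ < ε := by
  let ι := {p : (ℕ → ℂ) × 𝓜(ℂ, B) // (∀ j, ‖p.1 j‖ ≤ 1) ∧
    StrictlySumsTo (fun j => p.1 j • (e j - e (j - 1))) p.2}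
  let R : ℕ → ι → ι → Prop := fun M p q => ∀ j ≤ M, p.1.1 j = q.1.1 j
  have hR : ∀ M N, M ≤ N → ∀ p q, R N p q → R M p q :=
    fun M N hMN p q h j hj => h j (hj.trans hMN)
  have hα' (p : ι) (j : ℕ) : ‖star (p.1.1 j)‖ ≤ 1 := by
    rw [norm_star]
    exact p.2.1 j
  have hstar (p : ι) :
      StrictlySumsTo (fun j => star (p.1.1 j) • (e j - e (j - 1))) (star p.1.2) := by
    have h := p.2.2.star
    simpa [(he.1 _).isSelfAdjoint.star_eq] using h
  have hY : ∀ z, (fun p : ι => p.1.2.fst z) ∈ almostCylinderFunctions B R :=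
    he.fst_apply_mem_almostCylinderFunctions he0 hee (fun p => p.2.1)
      (fun k => ⟨k, fun p q h => h k le_rfl⟩) (fun p => p.2.2)
  have hYs : ∀ z, (fun p : ι => (star p.1.2).fst z) ∈ almostCylinderFunctions B R :=
    he.fst_apply_mem_almostCylinderFunctions he0 hee hα'
      (fun k => ⟨k, fun p q h => congrArg star (h k le_rfl)⟩) hstar
  have hYn (p : ι) : ‖p.1.2‖ ≤ 6 := by
    rw [← DoubleCentralizer.norm_fst]
    exact he.norm_fst_le he0 hee p.2.1 p.2.2
  have hYX (p : ι) : ‖(p.1.2 * X).fst‖ ≤ 6 := by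
    rw [DoubleCentralizer.norm_fst]
    refine (norm_mul_le _ _).trans ?_
    nlinarith [hYn p, norm_nonneg X, norm_nonneg p.1.2]
  have hYXs (p : ι) : ‖(star (p.1.2 * X)).fst‖ ≤ 6 := by
    rw [DoubleCentralizer.norm_fst, norm_star, ← DoubleCentralizer.norm_fst]
    exact hYX p
  have hT (z : B) : (fun p : ι => (p.1.2 * X).fst z) ∈ almostCylinderFunctions B R := by
    simpa using hY (X.fst z)
  have hTs (z : B) : (fun p : ι => (star (p.1.2 * X)).fst z) ∈ almostCylinderFunctions B R := by
    simp only [star_mul, DoubleCentralizer.mul_fst, mul_apply_eq_comp]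
    exact apply_mem_almostCylinderFunctions hR (T := fun _ => (star X).fst) (fun _ => le_rfl)
      (fun z => const_mem_almostCylinderFunctions _) (hYs z)
  have hF : (fun p : ι => (laurentEval Nh Mh β γ (p.1.2 * X)).fst y) ∈
      almostCylinderFunctions B R := by
    have hsum : (fun p : ι => (laurentEval Nh Mh β γ (p.1.2 * X)).fst y) =
        ∑ n ∈ Finset.range (Nh + 1), β n • (fun p : ι => ((p.1.2 * X).fst ^ n) y) +
          ∑ m ∈ Finset.Icc 1 Mh, γ m • (fun p : ι => ((star (p.1.2 * X)).fst ^ m) y) := by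
      ext p
      simp only [laurentEval_fst_apply, Pi.add_apply, Finset.sum_apply, Pi.smul_apply]
    rw [hsum]
    exact Submodule.add_mem _
      (Submodule.sum_mem _ fun n _ => Submodule.smul_mem _ _
        (pow_apply_mem_almostCylinderFunctions hR hYX hT n y))
      (Submodule.sum_mem _ fun m _ => Submodule.smul_mem _ _
        (pow_apply_mem_almostCylinderFunctions hR hYXs hTs m y))
  obtain ⟨M, hM⟩ := exists_norm_sub_lt_of_mem_almostCylinderFunctions hR hF hε
  refine ⟨M + 1, by omega, fun α α' hα hα' hαα' Y Y' hY hY' => ?_⟩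
  rw [← sub_mul, DoubleCentralizer.mul_coe_s7, DoubleCentralizer.norm_coe_s7,
    DoubleCentralizer.sub_fst, sub_apply]
  exact hM ⟨(α, Y), hα, hY⟩ ⟨(α', Y'), hα', hY'⟩ fun j hj => hαα' j (by omega)
end

section
/- Let D be a C*-algebra, let a, b, c ∈ D be positive contractive elements, let x ∈ D, and let ε > 0 be such that a·b = b and ‖x b x* − c‖ < ε. Then there exists y ∈ D with ‖y‖ ≤ √(1 + ε) such that ‖y a y* − c‖ < ε. -/
/-- Let `D` be a C*-algebra, `a b c ∈ D` positive contractive elements,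
`x ∈ D` and `ε > 0` such that `a * b = b` and `‖x * b * x⋆ - c‖ < ε`.  Then there is
`y ∈ D` with `‖y‖ ≤ √(1 + ε)` such that `‖y * a * y⋆ - c‖ < ε`. -/
theorem statement_9 {D : Type*} [NonUnitalCStarAlgebra D] [PartialOrder D] [StarOrderedRing D]
    (a b c x : D) (ε : ℝ) (hε : 0 < ε)
    (ha : 0 ≤ a) (ha1 : ‖a‖ ≤ 1)
    (hb : 0 ≤ b) (hb1 : ‖b‖ ≤ 1)
    (hc : 0 ≤ c) (hc1 : ‖c‖ ≤ 1)
    (hab : a * b = b)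
    (hx : ‖x * b * star x - c‖ < ε) :
    ∃ y : D, ‖y‖ ≤ Real.sqrt (1 + ε) ∧ ‖y * a * star y - c‖ < ε := by
  set s := CFC.sqrt b
  have hs : star s = s := (CFC.sqrt_nonneg b).isSelfAdjoint.star_eq
  have hss : s * s = b := CFC.sqrt_mul_sqrt_self b hb
  have hba : b * a = b := by
    simpa [ha.isSelfAdjoint.star_eq, hb.isSelfAdjoint.star_eq] using congrArg star hab
  have has : a * s = s := by
    rw [← sub_eq_zero, ← CStarRing.mul_star_self_eq_zero_iff]
    calc (a * s - s) * star (a * s - s)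
        = a * (s * s) * a - a * (s * s) - (s * s) * a + s * s := by
          rw [star_sub, star_mul, hs, ha.isSelfAdjoint.star_eq]
          noncomm_ring
      _ = 0 := by rw [hss, hab, hba]; abel
  have hxs : x * s * star (x * s) = x * b * star x := by
    rw [star_mul, hs, ← hss]
    simp only [mul_assoc]
  have hxas : x * s * a * star (x * s) = x * b * star x := by
    rw [← hxs, star_mul, hs, mul_assoc (x * s) a, ← mul_assoc a, has]
  refine ⟨x * s, ?_, by rwa [hxas]⟩
  apply Real.le_sqrt_of_sq_le
  have hnorm : ‖x * b * star x‖ ≤ ‖x * b * star x - c‖ + ‖c‖ := by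
    simpa using norm_add_le (x * b * star x - c) c
  rw [sq, ← CStarRing.norm_self_mul_star, hxs]
  linarith
end
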